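/- Let C and D be symmetric monoidal categories and let F : C ⥤ D be a strong symmetric monoidal functor admitting a left adjoint L : D ⥤ C and a right adjoint R : D ⥤ C. Suppose that the canonical projection morphisms π♯ : L(M ⊗ F(X)) ⟶ L(M) ⊗ X (the oplax C-linearity morphism of L induced from the adjunction L ⊣ F and the monoidal structure of F) and π* : R(M) ⊗ X ⟶ R(M ⊗ F(X)) (the lax C-linearity morphism of R induced from the adjunction F ⊣ R) are isomorphisms for all M in D and X in C. Then L(𝟙_D) is a dualizable object of C, with dual R(𝟙_D); the evaluation and coevaluation morphisms are constructed from the units and counits of the two adjunctions together with the projection isomorphisms. -/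

import Mathlib

open CategoryTheory MonoidalCategory Functor.LaxMonoidal Functor.OplaxMonoidal

variable {C D : Type*} [Category C] [Category D]
  [MonoidalCategory C] [MonoidalCategory D]

/-- The projection morphism `π♯ : L(M ⊗ F(X)) ⟶ L(M) ⊗ X`, the oplax `C`-linearity
morphism of `L` induced from the adjunction `L ⊣ F` and the monoidal structure of `F`. -/
noncomputable def projSharp (F : C ⥤ D) [F.Monoidal] (L : D ⥤ C) (adjL : L ⊣ F)
    (M : D) (X : C) : L.obj (M ⊗ F.obj X) ⟶ L.obj M ⊗ X :=
  L.map ((adjL.unit.app M ▷ F.obj X) ≫ μ F (L.obj M) X) ≫ adjL.counit.app (L.obj M ⊗ X)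

/-- The projection morphism `π* : R(M) ⊗ X ⟶ R(M ⊗ F(X))`, the lax `C`-linearity morphism
of `R` induced from the adjunction `F ⊣ R` and the monoidal structure of `F`. -/
noncomputable def projStar (F : C ⥤ D) [F.Monoidal] (R : D ⥤ C) (adjR : F ⊣ R)
    (M : D) (X : C) : R.obj M ⊗ X ⟶ R.obj (M ⊗ F.obj X) :=
  adjR.unit.app (R.obj M ⊗ X) ≫
    R.map (δ F (R.obj M) X ≫ (adjR.counit.app M ▷ F.obj X))

lemma unit_map_projSharp (F : C ⥤ D) [F.Monoidal] (L : D ⥤ C) (adjL : L ⊣ F) (M : D) (X : C) :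
    adjL.unit.app (M ⊗ F.obj X) ≫ F.map (projSharp F L adjL M X) =
      adjL.unit.app M ▷ F.obj X ≫ μ F (L.obj M) X := by
  have h := adjL.homEquiv_unit (f := projSharp F L adjL M X)
  rw [← h, projSharp, ← adjL.homEquiv_counit, Equiv.apply_symm_apply]

lemma projSharp_naturality_right (F : C ⥤ D) [F.Monoidal] (L : D ⥤ C) (adjL : L ⊣ F)
    (M : D) {X Y : C} (f : X ⟶ Y) :
    projSharp F L adjL M X ≫ L.obj M ◁ f =
      L.map (M ◁ F.map f) ≫ projSharp F L adjL M Y := by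
  apply (adjL.homEquiv _ _).injective
  simp only [Adjunction.homEquiv_unit, Functor.map_comp, Adjunction.unit_naturality_assoc,
    unit_map_projSharp, reassoc_of% unit_map_projSharp]
  rw [← μ_natural_right, whisker_exchange_assoc]
  rfl

lemma projSharp_naturality_left (F : C ⥤ D) [F.Monoidal] (L : D ⥤ C) (adjL : L ⊣ F)
    {M N : D} (g : M ⟶ N) (X : C) :
    projSharp F L adjL M X ≫ L.map g ▷ X =
      L.map (g ▷ F.obj X) ≫ projSharp F L adjL N X := by
  apply (adjL.homEquiv _ _).injective
  simp only [Adjunction.homEquiv_unit, Functor.map_comp, Adjunction.unit_naturality_assoc,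
    unit_map_projSharp, reassoc_of% unit_map_projSharp]
  rw [← μ_natural_left, ← comp_whiskerRight_assoc, ← comp_whiskerRight_assoc,
    Adjunction.unit_naturality]

lemma projSharp_associativity (F : C ⥤ D) [F.Monoidal] (L : D ⥤ C) (adjL : L ⊣ F)
    (M : D) (X Y : C) :
    projSharp F L adjL M (X ⊗ Y) ≫ (α_ (L.obj M) X Y).inv =
      L.map (M ◁ δ F X Y ≫ (α_ M (F.obj X) (F.obj Y)).inv) ≫
        projSharp F L adjL (M ⊗ F.obj X) Y ≫ projSharp F L adjL M X ▷ Y := by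
  apply (adjL.homEquiv _ _).injective
  simp only [Adjunction.homEquiv_unit, Functor.map_comp, Adjunction.unit_naturality_assoc,
    reassoc_of% unit_map_projSharp, Category.assoc]
  rw [← μ_natural_left, ← comp_whiskerRight_assoc, unit_map_projSharp, comp_whiskerRight_assoc,
    ← associator_inv_naturality_left_assoc, whisker_exchange_assoc]
  dsimp only [Functor.comp_obj, Functor.id_obj]
  rw [← Functor.LaxMonoidal.associativity_inv, Functor.Monoidal.whiskerLeft_δ_μ_assoc]

/-- A partial converse to `tensorLeftAdjunction`: a pairing `e : A ⊗ B ⟶ 𝟙_ C` which induces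
bijections `(X ⟶ B ⊗ Y) ≃ (A ⊗ X ⟶ Y)` is the evaluation of an exact pairing. -/
lemma nonempty_exactPairing_of_bijective {A B : C} (e : A ⊗ B ⟶ 𝟙_ C)
    (he : ∀ X Y : C, Function.Bijective fun f : X ⟶ B ⊗ Y ↦
      A ◁ f ≫ (α_ A B Y).inv ≫ e ▷ Y ≫ (λ_ Y).hom) :
    Nonempty (ExactPairing B A) := by
  obtain ⟨c, hc⟩ := (he (𝟙_ C) A).2 (ρ_ A).hom
  have hc' : A ◁ c ≫ (α_ A B A).inv ≫ e ▷ A = (ρ_ A).hom ≫ (λ_ A).inv := by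
    rw [← hc]; simp
  refine ⟨⟨c, e, hc', (he _ _).1 ?_⟩⟩
  have h₁ : A ◁ (c ▷ B ≫ (α_ B A B).hom ≫ B ◁ e) ≫ (α_ A B (𝟙_ C)).inv ≫
      e ▷ 𝟙_ C ≫ (λ_ (𝟙_ C)).hom =
      (α_ A (𝟙_ C) B).inv ≫ (A ◁ c ≫ (α_ A B A).inv ≫ e ▷ A) ▷ B ≫
        (α_ (𝟙_ C) A B).hom ≫ (λ_ (A ⊗ B)).hom ≫ e := by
    calc
      _ = 𝟙 _ ⊗≫ A ◁ c ▷ B ⊗≫ ((A ⊗ B) ◁ e ≫ e ▷ 𝟙_ C) ⊗≫ 𝟙 _ := by monoidal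
      _ = 𝟙 _ ⊗≫ A ◁ c ▷ B ⊗≫ (e ▷ (A ⊗ B) ≫ 𝟙_ C ◁ e) ⊗≫ 𝟙 _ := by rw [whisker_exchange]
      _ = _ := by monoidal
  dsimp only
  rw [h₁, hc']
  have h₂ : e ▷ 𝟙_ C ≫ (λ_ (𝟙_ C)).hom = (ρ_ (A ⊗ B)).hom ≫ e := by
    monoidal
  rw [h₂]
  monoidal

/-- The pairing `L(𝟙_ D) ⊗ R(𝟙_ D) ⟶ 𝟙_ C` given by the inverse of `π♯` and the two counits. -/
noncomputable def projPairing (F : C ⥤ D) [F.Monoidal] (L R : D ⥤ C) (adjL : L ⊣ F) (adjR : F ⊣ R)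
    [IsIso (projSharp F L adjL (𝟙_ D) (R.obj (𝟙_ D)))] :
    L.obj (𝟙_ D) ⊗ R.obj (𝟙_ D) ⟶ 𝟙_ C :=
  inv (projSharp F L adjL (𝟙_ D) (R.obj (𝟙_ D))) ≫
    L.map ((λ_ _).hom ≫ adjR.counit.app (𝟙_ D) ≫ ε F) ≫ adjL.counit.app (𝟙_ C)

lemma projSharp_counit (F : C ⥤ D) [F.Monoidal] (L : D ⥤ C) (adjL : L ⊣ F) (X Y : C) :
    projSharp F L adjL (F.obj X) Y ≫ adjL.counit.app X ▷ Y =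
      L.map (μ F X Y) ≫ adjL.counit.app (X ⊗ Y) := by
  apply (adjL.homEquiv _ _).injective
  simp only [Adjunction.homEquiv_unit, Functor.map_comp, Adjunction.unit_naturality_assoc,
    reassoc_of% unit_map_projSharp, Adjunction.right_triangle_components, Category.comp_id]
  rw [← μ_natural_left, ← comp_whiskerRight_assoc, Adjunction.right_triangle_components,
    id_whiskerRight, Category.id_comp]
  rfl

/-- The map on hom-sets induced by `projPairing` is, up to `π♯` and `π*`, the composite of the
hom-set bijections of the two adjunctions. -/
lemma projSharp_comp_projPairing (F : C ⥤ D) [F.Monoidal] (L R : D ⥤ C)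
    (adjL : L ⊣ F) (adjR : F ⊣ R) [IsIso (projSharp F L adjL (𝟙_ D) (R.obj (𝟙_ D)))]
    {X Y : C} (f : X ⟶ R.obj (𝟙_ D) ⊗ Y) :
    projSharp F L adjL (𝟙_ D) X ≫ L.obj (𝟙_ D) ◁ f ≫ (α_ _ _ _).inv ≫
        projPairing F L R adjL adjR ▷ Y ≫ (λ_ Y).hom =
      (adjL.homEquiv _ _).symm ((λ_ _).hom ≫
        (adjR.homEquiv _ _).symm (f ≫ projStar F R adjR (𝟙_ D) Y) ≫ (λ_ _).hom) := by
  have hR : (adjR.homEquiv _ _).symm (f ≫ projStar F R adjR (𝟙_ D) Y) =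
      F.map f ≫ δ F (R.obj (𝟙_ D)) Y ≫ adjR.counit.app (𝟙_ D) ▷ F.obj Y := by
    rw [projStar, ← adjR.homEquiv_unit, Adjunction.homEquiv_naturality_left_symm,
      Equiv.symm_apply_apply]
  have hp : projSharp F L adjL (𝟙_ D) (R.obj (𝟙_ D)) ≫ projPairing F L R adjL adjR =
      L.map ((λ_ _).hom ≫ adjR.counit.app (𝟙_ D) ≫ ε F) ≫ adjL.counit.app (𝟙_ C) := by
    simp [projPairing]
  rw [hR, reassoc_of% projSharp_naturality_right, reassoc_of% projSharp_associativity,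
    ← comp_whiskerRight_assoc, hp, comp_whiskerRight_assoc,
    reassoc_of% projSharp_naturality_left, reassoc_of% projSharp_counit,
    ← Adjunction.counit_naturality, Adjunction.homEquiv_counit]
  simp only [← L.map_comp_assoc]
  congr 2
  simp only [Category.assoc, comp_whiskerRight, ← Functor.LaxMonoidal.left_unitality]
  simp [-Functor.LaxMonoidal.left_unitality]

/-- If a strong symmetric monoidal functor `F : C ⥤ D` has a left adjoint `L` and a right
adjoint `R`, and both projection morphisms are isomorphisms, then `L(𝟙_ D)` is a dualizable
object of `C` with dual `R(𝟙_ D)`. -/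
theorem dualizable_of_projection_formulas
    [SymmetricCategory C] [SymmetricCategory D]
    (F : C ⥤ D) [F.Monoidal] [F.Braided] (L R : D ⥤ C) (adjL : L ⊣ F) (adjR : F ⊣ R)
    (hsharp : ∀ (M : D) (X : C), IsIso (projSharp F L adjL M X))
    (hstar : ∀ (M : D) (X : C), IsIso (projStar F R adjR M X)) :
    Nonempty (ExactPairing (R.obj (𝟙_ D)) (L.obj (𝟙_ D))) := by
  refine nonempty_exactPairing_of_bijective (projPairing F L R adjL adjR) fun X Y ↦ ?_
  rw [← Function.Bijective.of_comp_iff' (f := fun g ↦ projSharp F L adjL (𝟙_ D) X ≫ g)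
    (Iso.homFromEquiv (asIso (projSharp F L adjL (𝟙_ D) X)).symm).bijective]
  simp only [Function.comp_def, projSharp_comp_projPairing]
  exact (((((asIso (projStar F R adjR (𝟙_ D) Y)).homToEquiv.trans
    (adjR.homEquiv _ _).symm).trans (λ_ _).homToEquiv).trans
    (λ_ _).symm.homFromEquiv).trans (adjL.homEquiv _ _).symm).bijective
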